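/- arXiv:1410.8465 — 7 statements merged into one kernel-verified Lean document; each statement's English description precedes it below -/
import Mathlib

section
/- Let n ≥ 1 be an integer and let F : ℍ → ℝⁿ be a Lipschitz map from the hyperbolic plane to Euclidean n-space. Then for every r > 0, every ε ∈ (0,1) and every integer k ≥ 2 there exist points p₁, …, p_k ∈ ℍ such that for all distinct i, j ∈ {1, …, k}: (i) every x in the ball B(p_i, r) and every y in the ball B(p_j, r) satisfy d(x, y) ≥ 1/ε (i.e. the hyperbolic distance between the balls B(p_i, r) and B(p_j, r) is at least 1/ε), and (ii) there exist x ∈ B(p_i, r) and y ∈ B(p_j, r) with ‖F(x) − F(y)‖ ≤ ε (i.e. the Euclidean distance between the sets F(B(p_i, r)) and F(B(p_j, r)) is at most ε). -/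
open Metric

/-- The hyperbolic distance between two points of the horocycle `Im z = 1`. -/
lemma sinh_half_dist_vadd_I (a b : ℝ) :
    Real.sinh (dist (a +ᵥ UpperHalfPlane.I) (b +ᵥ UpperHalfPlane.I) / 2) = |a - b| / 2 := by
  rw [UpperHalfPlane.sinh_half_dist, UpperHalfPlane.coe_vadd, UpperHalfPlane.coe_vadd,
    dist_add_right, Complex.dist_of_im_eq (by simp)]
  simp [Real.dist_eq]

lemma exists_mul_pow_lt_two_pow (K : ℝ) (n : ℕ) :
    ∃ t : ℕ, K * ((t : ℝ) + 1) ^ n < 2 ^ t := by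
  have h := (tendsto_pow_const_div_const_pow_of_one_lt n (one_lt_two (α := ℝ))).const_mul (2 * K)
  rw [mul_zero] at h
  obtain ⟨t, ht⟩ := (((Filter.tendsto_add_atTop_iff_nat 1).2 h).eventually_lt_const one_pos).exists
  refine ⟨t, ?_⟩
  rw [← mul_div_assoc, div_lt_one (by positivity), pow_succ] at ht
  push_cast at ht
  linarith

/-- Two vectors of `ℝⁿ` in the same cell of the grid of mesh `ε / n` are `ε`-close. -/
lemma norm_sub_le_of_floor_eq {n : ℕ} (hn : 1 ≤ n) {ε : ℝ} (hε : 0 < ε)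
    (u v : EuclideanSpace ℝ (Fin n)) (h : ∀ i, ⌊u i * (n / ε)⌋ = ⌊v i * (n / ε)⌋) :
    ‖u - v‖ ≤ ε := by
  have hn' : (1 : ℝ) ≤ n := by exact_mod_cast hn
  have hs : 0 < n / ε := by positivity
  have hcoord (i : Fin n) : ‖(u - v) i‖ ^ 2 ≤ (ε / n) ^ 2 := by
    have h1 := (Int.abs_sub_lt_one_of_floor_eq_floor (h i)).le
    rw [← sub_mul, abs_mul, abs_of_pos hs, ← le_div_iff₀ hs, one_div_div] at h1
    gcongr
    simpa using h1
  rw [EuclideanSpace.norm_eq]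
  apply Real.sqrt_le_iff.2 ⟨hε.le, _⟩
  calc ∑ i, ‖(u - v) i‖ ^ 2 ≤ ∑ _i : Fin n, (ε / n) ^ 2 := Finset.sum_le_sum fun i _ ↦ hcoord i
    _ = ε ^ 2 / n := by
      simp only [Finset.sum_const, Finset.card_univ, Fintype.card_fin, nsmul_eq_mul]
      field_simp
    _ ≤ ε ^ 2 := div_le_self (by positivity) hn'

/-- A sequence in `ℝⁿ` of logarithmic growth has arbitrarily many terms that are pairwise
`ε`-close. -/
lemma exists_injective_norm_sub_le {n : ℕ} (hn : 1 ≤ n) (f : ℕ → EuclideanSpace ℝ (Fin n)) (c : ℝ)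
    (hf : ∀ t m : ℕ, m < 2 ^ t → ‖f m - f 0‖ ≤ c * (t + 1)) {ε : ℝ} (hε : 0 < ε) (k : ℕ) :
    ∃ p : Fin k → ℕ, Function.Injective p ∧ ∀ i j, ‖f (p i) - f (p j)‖ ≤ ε := by
  obtain ⟨C, hC⟩ := exists_nat_ge (c * (n / ε))
  obtain ⟨t, ht⟩ := exists_mul_pow_lt_two_pow ((2 * C + 1) ^ n * k) n
  let g : ℕ → Fin n → ℤ := fun m i ↦ ⌊(f m - f 0) i * (n / ε)⌋
  let K : ℤ := C * (t + 1)
  let T : Finset (Fin n → ℤ) := Fintype.piFinset fun _ ↦ Finset.Icc (-K) K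
  have hmaps : ∀ m ∈ Finset.range (2 ^ t), g m ∈ T := by
    intro m hm
    refine Fintype.mem_piFinset.2 fun i ↦ ?_
    have habs : |(f m - f 0) i * (n / ε)| ≤ C * (t + 1) := by
      rw [abs_mul, abs_of_nonneg (by positivity : 0 ≤ n / ε)]
      calc |(f m - f 0) i| * (n / ε) ≤ c * (t + 1) * (n / ε) := by
            gcongr
            exact (PiLp.norm_apply_le _ i).trans (hf t m (Finset.mem_range.1 hm))
        _ = c * (n / ε) * (t + 1) := by ring
        _ ≤ C * (t + 1) := by gcongr
    obtain ⟨h1, h2⟩ := abs_le.1 habs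
    refine Finset.mem_Icc.2 ⟨Int.le_floor.2 ?_, ?_⟩
    · simpa [K] using h1
    · have : ((g m i : ℤ) : ℝ) ≤ (K : ℝ) := (Int.floor_le _).trans (by simpa [K] using h2)
      exact_mod_cast this
  have hcard : T.card * k < (Finset.range (2 ^ t)).card := by
    have hIcc : (Finset.Icc (-K) K).card = 2 * (C * (t + 1)) + 1 := by
      rw [Int.card_Icc]
      simp only [K]
      norm_cast
      omega
    have hT : T.card = (2 * (C * (t + 1)) + 1) ^ n := by
      simp [T, Fintype.card_piFinset, hIcc]
    rw [hT, Finset.card_range]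
    have : (2 * (C * (t + 1)) + 1) ^ n * k ≤ ((2 * C + 1) * (t + 1)) ^ n * k := by
      gcongr
      nlinarith
    refine this.trans_lt ?_
    rw [mul_pow, mul_right_comm]
    exact_mod_cast ht
  obtain ⟨y, -, hy⟩ := Finset.exists_lt_card_fiber_of_mul_lt_card_of_maps_to hmaps hcard
  obtain ⟨s, hs, hsk⟩ := Finset.exists_subset_card_eq hy.le
  refine ⟨s.orderEmbOfFin hsk, (s.orderEmbOfFin hsk).injective, fun i j ↦ ?_⟩
  have hg (i : Fin k) : g (s.orderEmbOfFin hsk i) = y :=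
    (Finset.mem_filter.1 (hs (s.orderEmbOfFin_mem hsk i))).2
  rw [← sub_sub_sub_cancel_right _ _ (f 0)]
  exact norm_sub_le_of_floor_eq hn hε _ _ fun l ↦ congrFun ((hg i).trans (hg j).symm) l

/-- Points of the horocycle `Im z = 1` at spacing `A` are at distance `O(log m)` from the
first one. -/
lemma dist_natCast_mul_vadd_I_le {A : ℝ} (hA : 0 ≤ A) {t m : ℕ} (hm : m < 2 ^ t) :
    dist ((m * A) +ᵥ UpperHalfPlane.I) (((0 : ℕ) * A) +ᵥ UpperHalfPlane.I) ≤ 2 * (t + A) := by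
  set d := dist ((m * A) +ᵥ UpperHalfPlane.I) (((0 : ℕ) * A) +ᵥ UpperHalfPlane.I)
  have hsinh : Real.sinh (d / 2) = m * A / 2 := by
    rw [sinh_half_dist_vadd_I, Nat.cast_zero, zero_mul, sub_zero, abs_of_nonneg (by positivity)]
  have hd : 0 ≤ d := dist_nonneg
  have hneg : Real.exp (-(d / 2)) ≤ 1 := Real.exp_le_one_iff.2 (by linarith)
  have hm' : (m : ℝ) ≤ 2 ^ t := by exact_mod_cast hm.le
  have htwo : (2 : ℝ) ^ t ≤ Real.exp t := by
    rw [← Real.exp_one_pow]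
    gcongr
    linarith [Real.add_one_le_exp 1]
  have hexp : Real.exp (d / 2) ≤ Real.exp (t + A) := by
    rw [Real.sinh_eq] at hsinh
    calc Real.exp (d / 2) ≤ m * A + 1 := by linarith
      _ ≤ Real.exp t * A + Real.exp t := by
        gcongr
        · exact hm'.trans htwo
        · exact Real.one_le_exp (by positivity)
      _ = Real.exp t * (A + 1) := by ring
      _ ≤ Real.exp t * Real.exp A := by
        gcongr
        exact Real.add_one_le_exp A
      _ = Real.exp (t + A) := (Real.exp_add _ _).symm
  linarith [Real.exp_le_exp.1 hexp]

/-- **Theorem 1 (i)–(ii) for the hyperbolic plane.**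
For any Lipschitz map `F : ℍ → ℝⁿ`, any `r > 0`, `ε ∈ (0,1)` and `k ≥ 2`, there are
points `p₁, …, p_k` in the hyperbolic plane such that the balls `B(pᵢ, r)` are at
Riemannian distance at least `1/ε` from each other, while their images under `F` are
at Euclidean distance at most `ε` from each other. -/
theorem hyperbolic_lipschitz_compression
    (n : ℕ) (hn : 1 ≤ n) (F : UpperHalfPlane → EuclideanSpace ℝ (Fin n))
    (hF : ∃ L : ℝ, 0 ≤ L ∧ ∀ x y : UpperHalfPlane, ‖F x - F y‖ ≤ L * dist x y)
    (r : ℝ) (hr : 0 < r) (ε : ℝ) (hε : ε ∈ Set.Ioo (0 : ℝ) 1)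
    (k : ℕ) (hk : 2 ≤ k) :
    ∃ p : Fin k → UpperHalfPlane, ∀ i j : Fin k, i ≠ j →
      (∀ x ∈ ball (p i) r, ∀ y ∈ ball (p j) r, 1 / ε ≤ dist x y) ∧
      (∃ x ∈ ball (p i) r, ∃ y ∈ ball (p j) r, ‖F x - F y‖ ≤ ε) := by
  obtain ⟨L, hL, hF⟩ := hF
  have hε0 : 0 < ε := hε.1
  let D : ℝ := 2 * r + 1 / ε
  let A : ℝ := 2 * Real.sinh (D / 2)
  have hA : 0 ≤ A := mul_nonneg zero_le_two (Real.sinh_nonneg_iff.2 (by positivity))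
  let q : ℕ → UpperHalfPlane := fun m ↦ (m * A) +ᵥ UpperHalfPlane.I
  have hq {a b : ℕ} (hab : a ≠ b) : D ≤ dist (q a) (q b) := by
    have h1 : (1 : ℝ) ≤ |(a : ℝ) - b| := by
      exact_mod_cast Int.one_le_abs (sub_ne_zero.2 (Nat.cast_injective.ne hab : (a : ℤ) ≠ b))
    have h2 : Real.sinh (D / 2) ≤ Real.sinh (dist (q a) (q b) / 2) := by
      rw [sinh_half_dist_vadd_I, ← sub_mul, abs_mul, abs_of_nonneg hA]
      have := mul_le_mul_of_nonneg_right h1 hA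
      simp only [A] at this ⊢
      linarith
    linarith [Real.sinh_le_sinh.1 h2]
  have hgrowth (t m : ℕ) (hm : m < 2 ^ t) :
      ‖F (q m) - F (q 0)‖ ≤ L * (2 * (1 + A)) * (t + 1) := by
    refine (hF _ _).trans ?_
    rw [mul_assoc]
    gcongr
    refine (dist_natCast_mul_vadd_I_le hA hm).trans ?_
    nlinarith [mul_nonneg hA t.cast_nonneg]
  obtain ⟨p, hp, hclose⟩ := exists_injective_norm_sub_le hn (fun m ↦ F (q m)) _ hgrowth hε0 k
  refine ⟨fun i ↦ q (p i), fun i j hij ↦ ⟨fun x hx y hy ↦ ?_, q (p i), mem_ball_self hr,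
    q (p j), mem_ball_self hr, hclose i j⟩⟩
  have h1 := hq (hp.ne hij)
  have h2 := dist_triangle4 (q (p i)) x y (q (p j))
  rw [mem_ball] at hx hy
  rw [dist_comm (q (p i)) x] at h2
  simp only [D] at h1
  linarith
end

section
/- Let n ≥ 1 be an integer and let F : ℍ → ℝⁿ be a Lipschitz map from the hyperbolic plane to Euclidean n-space. Then for every r > 0, every ε ∈ (0,1) and every integer k ≥ 2 there exist points p₁, …, p_k ∈ ℍ such that for all distinct i, j ∈ {1, …, k}: (i) every x in the ball B(p_i, r) and every y in the ball B(p_j, r) satisfy d(x, y) ≥ 1/ε, and (iii) the Hausdorff distance in ℝⁿ between the sets F(B(p_i, r)) and F(B(p_j, r)) is at most ε. -/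
open Metric

/-- A sequence in a finite-dimensional space growing at most logarithmically has arbitrarily large
finite sets of indices on which it is nearly constant. -/
theorem exists_injective_abs_sub_le_of_log_growth {ι : Type*} [Fintype ι] (G : ℕ → ι → ℝ) (C : ℝ)
    (hG : ∀ q j : ℕ, j < 2 ^ q → ∀ a, |G j a| ≤ C * (q + 1)) {δ : ℝ} (hδ : 0 < δ) (k : ℕ) :
    ∃ f : Fin k → ℕ, Function.Injective f ∧ ∀ i i' a, |G (f i) a - G (f i') a| ≤ δ := by
  classical
  set K : ℕ := ⌈C / δ⌉₊
  set d := Fintype.card ι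
  obtain ⟨q, hq⟩ : ∃ q : ℕ, ((2 * K + 1) * (q + 1)) ^ d * k < 2 ^ q := by
    have h := (tendsto_pow_const_div_const_pow_of_one_lt d (one_lt_two (α := ℝ))).comp
      (Filter.tendsto_add_atTop_nat 1)
    have hpos : (0 : ℝ) < 1 / (2 * ((2 * K + 1) ^ d * k + 1)) := by positivity
    obtain ⟨q, hq⟩ := (h.eventually (gt_mem_nhds hpos)).exists
    refine ⟨q, ?_⟩
    simp only [Function.comp_apply] at hq
    rw [div_lt_div_iff₀ (by positivity) (by positivity), pow_succ (2 : ℝ)] at hq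
    have hq1 : (0 : ℝ) < ((q : ℝ) + 1) ^ d := by positivity
    have : (((2 * K + 1) * (q + 1)) ^ d * k : ℝ) < 2 ^ q := by
      rw [mul_pow]
      push_cast at hq
      linarith
    exact_mod_cast this
  set cell : ℕ → ι → ℤ := fun j a => ⌊G j a / δ⌋
  set T : Finset (ι → ℤ) :=
    Fintype.piFinset fun _ => Finset.Icc (-(K * (q + 1) : ℤ)) (K * (q + 1) : ℤ)
  have hT : T.card * k < (Finset.range (2 ^ q)).card := by
    refine lt_of_le_of_lt (Nat.mul_le_mul_right k ?_) (hq.trans_eq (Finset.card_range _).symm)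
    simp only [T, Fintype.card_piFinset, Int.card_Icc, Finset.prod_const, Finset.card_univ]
    refine Nat.pow_le_pow_left ?_ d
    rw [Int.toNat_le]
    push_cast
    nlinarith [Int.natCast_nonneg q]
  have hmaps : ∀ j ∈ Finset.range (2 ^ q), cell j ∈ T := by
    intro j hj
    simp only [T, Fintype.mem_piFinset, Finset.mem_Icc]
    intro a
    have hb : |G j a / δ| ≤ K * (q + 1) := by
      rw [abs_div, abs_of_pos hδ]
      calc |G j a| / δ ≤ C * (q + 1) / δ := by gcongr; exact hG q j (Finset.mem_range.1 hj) a
        _ = C / δ * (q + 1) := by ring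
        _ ≤ K * (q + 1) := by gcongr; exact Nat.le_ceil _
    obtain ⟨h1, h2⟩ := abs_le.1 hb
    refine ⟨Int.le_floor.2 (by push_cast; exact h1), ?_⟩
    have : ((cell j a : ℤ) : ℝ) ≤ ((K * (q + 1) : ℤ) : ℝ) := by
      push_cast
      exact (Int.floor_le _).trans h2
    exact_mod_cast this
  obtain ⟨y, -, hy⟩ := Finset.exists_lt_card_fiber_of_mul_lt_card_of_maps_to hmaps hT
  set S := {j ∈ Finset.range (2 ^ q) | cell j = y}
  refine ⟨fun i => S.equivFin.symm (Fin.castLE hy.le i),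
    fun i i' h => Fin.castLE_injective hy.le (S.equivFin.symm.injective (Subtype.ext h)), ?_⟩
  intro i i' a
  have hcell : ∀ x : S, cell x a = y a := fun x => congrFun (Finset.mem_filter.1 x.2).2 a
  have := Int.abs_sub_lt_one_of_floor_eq_floor ((hcell _).trans (hcell _).symm :
    cell (S.equivFin.symm (Fin.castLE hy.le i)) a = cell (S.equivFin.symm (Fin.castLE hy.le i')) a)
  rw [← sub_div, abs_div, abs_of_pos hδ, div_lt_one hδ] at this
  exact this.le

namespace UpperHalfPlane

theorem dist_coe_real_vadd (a b : ℝ) (z : ℍ) :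
    dist ((a +ᵥ z : ℍ) : ℂ) (b +ᵥ z : ℍ) = |a - b| := by
  rw [coe_vadd, coe_vadd, dist_add_right, Complex.dist_eq, ← Complex.ofReal_sub,
    Complex.norm_real, Real.norm_eq_abs]

/-- Horizontal translations move points at logarithmic speed. -/
theorem dist_real_vadd_le (z : ℍ) {s t : ℝ} {q : ℕ} (ht : |t| ≤ s * 2 ^ q) :
    dist (t +ᵥ z) z ≤ 1 + (s / z.im) ^ 2 + 2 * q := by
  have hz := z.im_pos
  have hc := cosh_dist (t +ᵥ z) z
  have hd := dist_coe_real_vadd t 0 z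
  rw [zero_vadd, sub_zero] at hd
  rw [hd, vadd_im, sq_abs] at hc
  have ht2 : t ^ 2 ≤ s ^ 2 * 4 ^ q := by
    have := pow_le_pow_left₀ (abs_nonneg t) ht 2
    rwa [sq_abs, mul_pow, ← pow_mul, mul_comm q 2, pow_mul, show (2 : ℝ) ^ 2 = 4 by norm_num]
      at this
  have h4 : (1 : ℝ) ≤ 4 ^ q := one_le_pow₀ (by norm_num)
  have he4 : (4 : ℝ) ^ q ≤ Real.exp (2 * q) := by
    rw [mul_comm, Real.exp_nat_mul]
    refine pow_le_pow_left₀ (by norm_num) ?_ q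
    have h1 := Real.add_one_le_exp 1
    rw [show (2 : ℝ) = 1 + 1 by norm_num, Real.exp_add]
    nlinarith
  rw [← Real.exp_le_exp]
  calc Real.exp (dist (t +ᵥ z) z) ≤ 2 * Real.cosh (dist (t +ᵥ z) z) := by
        rw [Real.cosh_eq]; linarith [Real.exp_pos (-dist (t +ᵥ z) z)]
    _ = 2 + t ^ 2 / z.im ^ 2 := by rw [hc]; field_simp
    _ ≤ 2 * 4 ^ q + s ^ 2 * 4 ^ q / z.im ^ 2 := by gcongr; linarith
    _ = (1 + (s / z.im) ^ 2 + 1) * 4 ^ q := by field_simp; ring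
    _ ≤ Real.exp (1 + (s / z.im) ^ 2) * Real.exp (2 * q) := by
        gcongr; exact Real.add_one_le_exp _
    _ = _ := (Real.exp_add _ _).symm

theorem le_dist_real_vadd {D a b : ℝ} (h : Real.exp D ≤ |a - b|) :
    D ≤ dist (a +ᵥ I) (b +ᵥ I) := by
  have := dist_coe_le (a +ᵥ I) (b +ᵥ I)
  rw [dist_coe_real_vadd, vadd_im, I_im, one_mul] at this
  exact Real.exp_le_exp.1 (by linarith)

end UpperHalfPlane

theorem EuclideanSpace.norm_le_card_mul {ι : Type*} [Fintype ι] (v : EuclideanSpace ℝ ι) {δ : ℝ}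
    (hδ : 0 ≤ δ) (h : ∀ b, |v b| ≤ δ) : ‖v‖ ≤ Fintype.card ι * δ := by
  refine abs_le_of_sq_le_sq' ?_ (by positivity) |>.2
  rw [EuclideanSpace.norm_sq_eq]
  calc ∑ b, ‖v b‖ ^ 2 ≤ ∑ _b : ι, δ ^ 2 :=
        Finset.sum_le_sum fun b _ => pow_le_pow_left₀ (norm_nonneg _) (h b) 2
    _ = Fintype.card ι * δ ^ 2 := by simp
    _ ≤ (Fintype.card ι * δ) ^ 2 := by
        rw [mul_pow]
        gcongr
        exact_mod_cast Nat.le_self_pow two_ne_zero _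

open UpperHalfPlane in
/-- **Theorem 1 (i) and (iii) for the hyperbolic plane.**
For any Lipschitz map `F : ℍ → ℝⁿ`, any `r > 0`, `ε ∈ (0,1)` and `k ≥ 2`, there are
points `p₁, …, p_k` in the hyperbolic plane such that the balls `B(pᵢ, r)` are at
Riemannian distance at least `1/ε` from each other, while their images under `F` are
at Hausdorff distance at most `ε` from each other. -/
theorem hyperbolic_lipschitz_compression_hausdorff
    (n : ℕ) (hn : 1 ≤ n) (F : UpperHalfPlane → EuclideanSpace ℝ (Fin n))
    (hF : ∃ L : ℝ, 0 ≤ L ∧ ∀ x y : UpperHalfPlane, ‖F x - F y‖ ≤ L * dist x y)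
    (r : ℝ) (hr : 0 < r) (ε : ℝ) (hε : ε ∈ Set.Ioo (0 : ℝ) 1)
    (k : ℕ) (hk : 2 ≤ k) :
    ∃ p : Fin k → UpperHalfPlane, ∀ i j : Fin k, i ≠ j →
      (∀ x ∈ ball (p i) r, ∀ y ∈ ball (p j) r, 1 / ε ≤ dist x y) ∧
      Metric.hausdorffDist (F '' ball (p i) r) (F '' ball (p j) r) ≤ ε := by
  obtain ⟨L, hL, hF⟩ := hF
  have hε0 := hε.1
  have hn0 : (0 : ℝ) < n := by exact_mod_cast hn
  set s := Real.exp (1 / ε + 2 * r)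
  have hs : 0 < s := Real.exp_pos _
  set η := ε / (4 * (L + 1))
  have hη : 0 < η := by positivity
  set δ := ε / (2 * n)
  have hδ : 0 < δ := by positivity
  obtain ⟨t, -, htfin, hcov⟩ := finite_cover_balls_of_compact (isCompact_closedBall I r) hη
  have : Fintype t := htfin.fintype
  obtain ⟨A, hA⟩ : ∃ A : ℝ, ∀ z : t, (s / (z : UpperHalfPlane).im) ^ 2 ≤ A :=
    (Set.finite_range fun z : t => (s / (z : UpperHalfPlane).im) ^ 2).bddAbove.imp
      fun _ h z => h ⟨z, rfl⟩
  obtain ⟨f, hf, hclose⟩ := exists_injective_abs_sub_le_of_log_growth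
    (fun j (a : t × Fin n) => (F ((s * j : ℝ) +ᵥ (a.1 : UpperHalfPlane)) - F a.1) a.2)
    (L * (2 + |A|)) (fun q j hj a => by
      have hj' : |s * j| ≤ s * 2 ^ q := by
        rw [abs_of_nonneg (by positivity)]
        gcongr
        exact_mod_cast hj.le
      refine (PiLp.norm_apply_le _ a.2).trans ((hF _ _).trans ?_)
      rw [mul_assoc]
      refine mul_le_mul_of_nonneg_left ((dist_real_vadd_le _ hj').trans ?_) hL
      have := (hA a.1).trans (le_abs_self A)
      nlinarith [abs_nonneg A, Nat.cast_nonneg (α := ℝ) q]) hδ k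
  have hisom : ∀ (a : ℝ) (z w : UpperHalfPlane), dist (a +ᵥ z) (a +ᵥ w) = dist z w :=
    fun a => (isometry_real_vadd a).dist_eq
  have hnear : ∀ i j : Fin k, ∀ x ∈ F '' ball ((s * f i : ℝ) +ᵥ I) r,
      ∃ y ∈ F '' ball ((s * f j : ℝ) +ᵥ I) r, dist x y ≤ ε := by
    rintro i j _ ⟨x, hx, rfl⟩
    obtain ⟨y, rfl⟩ : ∃ y : UpperHalfPlane, (s * f i : ℝ) +ᵥ y = x :=
      ⟨-(s * f i : ℝ) +ᵥ x, vadd_neg_vadd _ _⟩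
    rw [mem_ball, hisom] at hx
    refine ⟨_, ⟨(s * f j : ℝ) +ᵥ y, by rwa [mem_ball, hisom], rfl⟩, ?_⟩
    obtain ⟨z, hz, hyz⟩ := Set.mem_iUnion₂.1 (hcov hx.le)
    have hLη : L * η ≤ ε / 4 := by
      rw [show ε / 4 = (L + 1) * η by simp only [η]; field_simp]
      gcongr
      linarith
    have hmove : ∀ a : ℝ, dist (F (a +ᵥ y)) (F (a +ᵥ z)) ≤ ε / 4 := fun a => by
      rw [dist_eq_norm]
      refine ((hF _ _).trans ?_).trans hLη
      rw [hisom]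
      gcongr
      exact (mem_ball.1 hyz).le
    have hmid : dist (F ((s * f i : ℝ) +ᵥ z)) (F ((s * f j : ℝ) +ᵥ z)) ≤ ε / 2 := by
      rw [dist_eq_norm]
      refine (EuclideanSpace.norm_le_card_mul _ hδ.le fun b => ?_).trans_eq ?_
      · simpa using hclose i j (⟨z, hz⟩, b)
      · simp only [δ, Fintype.card_fin]
        field_simp
    have h1 := dist_triangle4 (F ((s * f i : ℝ) +ᵥ y)) (F ((s * f i : ℝ) +ᵥ z))
      (F ((s * f j : ℝ) +ᵥ z)) (F ((s * f j : ℝ) +ᵥ y))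
    have h2 := hmove (s * f i)
    have h3 := hmove (s * f j)
    rw [dist_comm] at h3
    linarith
  refine ⟨fun i => (s * f i : ℝ) +ᵥ I, fun i j hij => ⟨fun x hx y hy => ?_,
    hausdorffDist_le_of_mem_dist hε0.le (hnear i j) fun x hx => hnear j i x hx⟩⟩
  have hsep : s ≤ |s * f i - s * f j| := by
    rw [← mul_sub, abs_mul, abs_of_pos hs]
    refine le_mul_of_one_le_right hs.le ?_
    have : (1 : ℤ) ≤ |(f i : ℤ) - f j| :=
      Int.one_le_abs (sub_ne_zero.2 (by exact_mod_cast hf.ne hij))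
    exact_mod_cast this
  have h1 := le_dist_real_vadd hsep
  have h2 := dist_triangle4 ((s * f i : ℝ) +ᵥ I) x y ((s * f j : ℝ) +ᵥ I)
  rw [mem_ball] at hx hy
  rw [dist_comm] at hx
  linarith
end

section
/- Let n ≥ 1 be an integer and let F : ℍ → ℝⁿ be a Lipschitz map from the hyperbolic plane to Euclidean n-space. Then for every integer k ≥ 2 there exist k sequences (x_l^{(1)})_{l∈ℕ}, …, (x_l^{(k)})_{l∈ℕ} of points of ℍ such that for all distinct i, j ∈ {1, …, k} one has d(x_l^{(i)}, x_l^{(j)}) → ∞ and ‖F(x_l^{(i)}) − F(x_l^{(j)})‖ → 0 as l → ∞. -/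
open Filter

/-- The point `a + i` on the horocycle at height one. -/
noncomputable def horocyclePoint (a : ℝ) : UpperHalfPlane :=
  ⟨⟨a, 1⟩, one_pos⟩

theorem cosh_dist_horocyclePoint (a b : ℝ) :
    Real.cosh (dist (horocyclePoint a) (horocyclePoint b)) = 1 + (a - b) ^ 2 / 2 := by
  have h : dist (⟨a, 1⟩ : ℂ) ⟨b, 1⟩ = |a - b| := by
    exact (Complex.dist_of_im_eq (by rfl)).trans (Real.dist_eq a b)
  rw [UpperHalfPlane.cosh_dist]
  change 1 + dist (⟨a, 1⟩ : ℂ) ⟨b, 1⟩ ^ 2 / (2 * 1 * 1) = _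
  rw [h, sq_abs]
  ring

theorem le_dist_horocyclePoint {R a b : ℝ} (h : Real.exp R ≤ |a - b|) :
    R ≤ dist (horocyclePoint a) (horocyclePoint b) := by
  rw [← Real.exp_le_exp]
  have hc := cosh_dist_horocyclePoint a b
  set d := dist (horocyclePoint a) (horocyclePoint b)
  have hd : Real.exp (-d) ≤ Real.exp d := Real.exp_le_exp.2 (by
    linarith [dist_nonneg (x := horocyclePoint a) (y := horocyclePoint b)])
  rw [Real.cosh_eq] at hc
  have h2 : Real.exp R ^ 2 ≤ (a - b) ^ 2 := by
    rw [← sq_abs (a - b)]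
    gcongr
  nlinarith [sq_nonneg (Real.exp R - 1)]

theorem dist_horocyclePoint_le (a b : ℝ) :
    dist (horocyclePoint a) (horocyclePoint b) ≤ Real.log (2 + (a - b) ^ 2) := by
  rw [Real.le_log_iff_exp_le (by positivity)]
  have hc := cosh_dist_horocyclePoint a b
  rw [Real.cosh_eq] at hc
  linarith [Real.exp_pos (-dist (horocyclePoint a) (horocyclePoint b))]

/-- Pigeonhole on a grid of mesh `δ`: among more than `(2 * K + 1) ^ n * k` points of `ℝⁿ` whose
coordinates are at most `K * δ` in absolute value, some `k` are pairwise `δ`-close in every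
coordinate. -/
theorem exists_embedding_coord_close {n k N K : ℕ} {δ : ℝ} (hδ : 0 < δ)
    (v : Fin N → Fin n → ℝ) (hv : ∀ j t, |v j t| ≤ K * δ) (hN : (2 * K + 1) ^ n * k < N) :
    ∃ e : Fin k ↪ Fin N, ∀ i j t, |v (e i) t - v (e j) t| ≤ δ := by
  classical
  let c : Fin N → Fin n → ℤ := fun j t => ⌊v j t / δ⌋
  let T : Finset (Fin n → ℤ) := Fintype.piFinset fun _ => Finset.Icc (-(K : ℤ)) K
  have hT : T.card = (2 * K + 1) ^ n := by
    simp only [T, Fintype.card_piFinset_const, Int.card_Icc]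
    congr 1
    omega
  have hmaps : ∀ j ∈ (Finset.univ : Finset (Fin N)), c j ∈ T := by
    intro j _
    simp only [T, c, Fintype.mem_piFinset, Finset.mem_Icc]
    intro t
    have h := abs_le.1 (hv j t)
    constructor
    · rw [Int.le_floor, le_div_iff₀ hδ]
      push_cast
      linarith [h.1]
    · have : (⌊v j t / δ⌋ : ℝ) ≤ K := (Int.floor_le _).trans ((div_le_iff₀ hδ).2 h.2)
      exact_mod_cast this
  obtain ⟨y, -, hy⟩ := Finset.exists_lt_card_fiber_of_mul_lt_card_of_maps_to hmaps
    (n := k) (by rw [hT, Finset.card_univ, Fintype.card_fin]; exact hN)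
  obtain ⟨S, hS, hcard⟩ := Finset.exists_subset_card_eq hy.le
  refine ⟨(S.orderEmbOfFin hcard).toEmbedding, fun i j t => ?_⟩
  have hmem : ∀ i, c (S.orderEmbOfFin hcard i) = y := fun i =>
    (Finset.mem_filter.1 (hS (S.orderEmbOfFin_mem hcard i))).2
  have h := Int.abs_sub_lt_one_of_floor_eq_floor (congrFun ((hmem i).trans (hmem j).symm) t)
  rw [← sub_div, abs_div, abs_of_pos hδ, div_lt_one hδ] at h
  exact h.le

theorem EuclideanSpace.norm_le_card_mul_s2 {n : ℕ} (v : EuclideanSpace ℝ (Fin n)) {δ : ℝ}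
    (hv : ∀ t, |v t| ≤ δ) : ‖v‖ ≤ n * δ := by
  rcases Nat.eq_zero_or_pos n with rfl | hn
  · simp [Subsingleton.elim v 0]
  have hδ : 0 ≤ δ := (abs_nonneg _).trans (hv ⟨0, hn⟩)
  rw [EuclideanSpace.norm_eq]
  refine Real.sqrt_le_iff.2 ⟨by positivity, ?_⟩
  calc ∑ t, ‖v t‖ ^ 2 ≤ ∑ _t : Fin n, δ ^ 2 :=
        Finset.sum_le_sum fun t _ => by
          rw [Real.norm_eq_abs]
          exact pow_le_pow_left₀ (abs_nonneg _) (hv t) 2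
    _ = n * δ ^ 2 := by simp
    _ ≤ (n * δ) ^ 2 := by
        have : (1 : ℝ) ≤ n := by exact_mod_cast hn
        nlinarith [mul_nonneg (mul_nonneg (by linarith : (0 : ℝ) ≤ n) (sub_nonneg.2 this))
          (sq_nonneg δ)]

theorem exists_mul_pow_mul_lt_two_pow (A n k : ℕ) :
    ∃ m : ℕ, 1 ≤ m ∧ (2 * (A * m) + 1) ^ n * k < 2 ^ m := by
  have h := (tendsto_pow_const_div_const_pow_of_one_lt n (one_lt_two : (1 : ℝ) < 2)).const_mul
    (((2 * A + 1) ^ n * k : ℕ) : ℝ)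
  rw [mul_zero] at h
  obtain ⟨m, hm, hm1⟩ := ((h.eventually_lt_const one_pos).and (eventually_ge_atTop 1)).exists
  refine ⟨m, hm1, ?_⟩
  rw [← mul_div_assoc, div_lt_one (by positivity)] at hm
  have hm' : ((2 * A + 1) ^ n * k) * m ^ n < 2 ^ m := by exact_mod_cast hm
  calc (2 * (A * m) + 1) ^ n * k ≤ ((2 * A + 1) * m) ^ n * k := by
        gcongr
        nlinarith
    _ = ((2 * A + 1) ^ n * k) * m ^ n := by rw [mul_pow]; ring
    _ < 2 ^ m := hm'

theorem exists_separated_points_images_close {n : ℕ} {F : UpperHalfPlane → EuclideanSpace ℝ (Fin n)}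
    {L : ℝ} (hL : 0 ≤ L) (hF : ∀ x y : UpperHalfPlane, ‖F x - F y‖ ≤ L * dist x y)
    (k : ℕ) (R : ℝ) {ε : ℝ} (hε : 0 < ε) :
    ∃ p : Fin k → UpperHalfPlane, ∀ i j, i ≠ j →
      R ≤ dist (p i) (p j) ∧ ‖F (p i) - F (p j)‖ ≤ ε := by
  set D := Real.exp R
  have hD : 0 < D := Real.exp_pos R
  set δ := ε / (n + 1)
  have hδ : 0 < δ := by positivity
  set C := Real.log 4 + Real.log (2 + D ^ 2)
  obtain ⟨A, hA⟩ := exists_nat_ge (L * C / δ)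
  obtain ⟨m, hm1, hm⟩ := exists_mul_pow_mul_lt_two_pow A n k
  let q : ℕ → UpperHalfPlane := fun j => horocyclePoint (j * D)
  have hq : ∀ j < 2 ^ m, dist (q j) (q 0) ≤ m * C := by
    intro j hj
    have hj' : (j : ℝ) ^ 2 ≤ 4 ^ m := by
      have : (j : ℝ) ≤ 2 ^ m := by exact_mod_cast hj.le
      calc (j : ℝ) ^ 2 ≤ (2 ^ m) ^ 2 := by gcongr
        _ = 4 ^ m := by rw [← pow_mul, mul_comm, pow_mul]; norm_num
    have h4 : (1 : ℝ) ≤ 4 ^ m := one_le_pow₀ (by norm_num)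
    have hlog : 0 ≤ Real.log (2 + D ^ 2) := Real.log_nonneg (by nlinarith)
    have hm1' : (1 : ℝ) ≤ m := by exact_mod_cast hm1
    calc dist (q j) (q 0) ≤ Real.log (2 + (j * D - (0 : ℕ) * D) ^ 2) :=
          dist_horocyclePoint_le _ _
      _ ≤ Real.log (4 ^ m * (2 + D ^ 2)) := by
          apply Real.log_le_log (by positivity)
          have := mul_le_mul_of_nonneg_right hj' (sq_nonneg D)
          push_cast
          nlinarith
      _ = m * Real.log 4 + Real.log (2 + D ^ 2) := by
          rw [Real.log_mul (by positivity) (by positivity), Real.log_pow]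
      _ ≤ m * C := by
          simp only [C]
          nlinarith
  obtain ⟨e, he⟩ := exists_embedding_coord_close (K := A * m) hδ
    (fun (j : Fin (2 ^ m)) t => (F (q j) - F (q 0)) t) (fun j t => by
      rw [div_le_iff₀ hδ] at hA
      calc |(F (q j) - F (q 0)) t| ≤ ‖F (q j) - F (q 0)‖ := by
            simpa only [Real.norm_eq_abs] using PiLp.norm_apply_le (F (q j) - F (q 0)) t
        _ ≤ L * dist (q j) (q 0) := hF _ _
        _ ≤ L * (m * C) := by gcongr; exact hq j j.2
        _ = m * (L * C) := by ring
        _ ≤ m * (A * δ) := by gcongr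
        _ = (A * m : ℕ) * δ := by push_cast; ring) hm
  refine ⟨fun i => q (e i), fun i j hij => ⟨le_dist_horocyclePoint ?_, ?_⟩⟩
  · have hne : ((e i : ℕ) : ℤ) - (e j : ℕ) ≠ 0 := fun h =>
      hij (e.injective (Fin.ext (by omega)))
    have h1 : (1 : ℝ) ≤ |((e i : ℕ) : ℝ) - (e j : ℕ)| := by
      exact_mod_cast Int.one_le_abs hne
    rw [← sub_mul, abs_mul, abs_of_pos hD]
    exact le_mul_of_one_le_left hD.le h1
  · calc ‖F (q (e i)) - F (q (e j))‖ ≤ n * δ :=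
          EuclideanSpace.norm_le_card_mul_s2 _ fun t => by simpa using he i j t
      _ ≤ (n + 1) * δ := by gcongr; linarith
      _ = ε := by simp only [δ]; field_simp

/-- **Corollary (sequences version).**
For any Lipschitz map `F : ℍ → ℝⁿ` and any `k ≥ 2`, there are `k` sequences of points
in the hyperbolic plane that pairwise spread out to infinity in the hyperbolic metric,
while their images under `F` pairwise converge together in `ℝⁿ`. -/
theorem hyperbolic_lipschitz_sequences
    (n : ℕ) (hn : 1 ≤ n) (F : UpperHalfPlane → EuclideanSpace ℝ (Fin n))
    (hF : ∃ L : ℝ, 0 ≤ L ∧ ∀ x y : UpperHalfPlane, ‖F x - F y‖ ≤ L * dist x y)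
    (k : ℕ) (hk : 2 ≤ k) :
    ∃ x : Fin k → ℕ → UpperHalfPlane, ∀ i j : Fin k, i ≠ j →
      Tendsto (fun l => dist (x i l) (x j l)) atTop atTop ∧
      Tendsto (fun l => ‖F (x i l) - F (x j l)‖) atTop (nhds 0) := by
  obtain ⟨L, hL, hF⟩ := hF
  have h : ∀ l : ℕ, ∃ p : Fin k → UpperHalfPlane, ∀ i j, i ≠ j →
      (l : ℝ) ≤ dist (p i) (p j) ∧ ‖F (p i) - F (p j)‖ ≤ 1 / ((l : ℝ) + 1) := fun l =>
    exists_separated_points_images_close hL hF k l (by positivity)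
  choose p hp using h
  refine ⟨fun i l => p l i, fun i j hij => ⟨?_, ?_⟩⟩
  · exact tendsto_atTop_mono (fun l => (hp l i j hij).1) tendsto_natCast_atTop_atTop
  · exact squeeze_zero (fun _ => norm_nonneg _) (fun l => (hp l i j hij).2)
      tendsto_one_div_add_atTop_nhds_zero_nat
end

section
/- For every C > 0 and every point p of the hyperbolic plane ℍ, the packing number #(p, C, R) grows exponentially in R: there exist constants a > 0, b > 0 and R₀ > 0 such that for all R ≥ R₀ one has #(p, C, R) ≥ a·exp(b·R); that is, there exists a finite set S ⊆ ℍ of cardinality at least a·exp(b·R) such that the open balls B(s, C), s ∈ S, are pairwise disjoint and all contained in B(p, R). -/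
open Metric

/-- The distance between two horizontal translates of `p`. -/
theorem sinh_half_dist_real_vadd (p : UpperHalfPlane) (u v : ℝ) :
    Real.sinh (dist (u +ᵥ p) (v +ᵥ p) / 2) = |u - v| / (2 * p.im) := by
  rw [UpperHalfPlane.sinh_half_dist, UpperHalfPlane.vadd_im, UpperHalfPlane.vadd_im,
    Real.sqrt_mul_self p.im_pos.le, UpperHalfPlane.coe_vadd, UpperHalfPlane.coe_vadd,
    dist_add_right, Complex.dist_eq, ← Complex.ofReal_sub, Complex.norm_real, Real.norm_eq_abs]

theorem exp_div_four_le_sinh {x : ℝ} (hx : 1 ≤ x) : Real.exp x / 4 ≤ Real.sinh x := by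
  have h₁ : 2 ≤ Real.exp x := by linarith [Real.add_one_le_exp x]
  have h₂ : Real.exp (-x) ≤ 1 := Real.exp_le_one_iff.mpr (by linarith)
  rw [Real.sinh_eq]
  linarith

/-- **Exponential growth of packings in the hyperbolic plane.**
For every `C > 0` and every `p ∈ ℍ` there are constants `a, b, R₀ > 0` such that for
all `R ≥ R₀` one can find at least `a·exp(b·R)` pairwise disjoint open balls of radius
`C` inside the ball `B(p, R)`. -/
theorem hyperbolic_packing_exponential_growth (C : ℝ) (hC : 0 < C) (p : UpperHalfPlane) :
    ∃ a b R₀ : ℝ, 0 < a ∧ 0 < b ∧ 0 < R₀ ∧ ∀ R : ℝ, R₀ ≤ R →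
      ∃ S : Finset UpperHalfPlane,
        a * Real.exp (b * R) ≤ (S.card : ℝ) ∧
        (∀ s ∈ S, ball s C ⊆ ball p R) ∧
        (S : Set UpperHalfPlane).Pairwise fun s t => Disjoint (ball s C) (ball t C) := by
  classical
  have hs : 0 < Real.sinh C := Real.sinh_pos_iff.mpr hC
  have hy : 0 < p.im := p.im_pos
  let f : ℕ → UpperHalfPlane := fun k => ((k : ℝ) * (2 * p.im * Real.sinh C)) +ᵥ p
  have hf (k l : ℕ) : Real.sinh (dist (f k) (f l) / 2) = |(k : ℝ) - l| * Real.sinh C := by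
    rw [sinh_half_dist_real_vadd, ← sub_mul, abs_mul,
      abs_of_pos (by positivity : 0 < 2 * p.im * Real.sinh C)]
    field_simp
  have hf₀ : f 0 = p := by simp [f]
  have hsep {k l : ℕ} (hkl : k ≠ l) : C + C ≤ dist (f k) (f l) := by
    have h₁ : (1 : ℝ) ≤ |(k : ℝ) - l| := by
      have : (1 : ℤ) ≤ |(k : ℤ) - l| := Int.one_le_abs (by omega)
      exact_mod_cast this
    have h₂ : Real.sinh C ≤ Real.sinh (dist (f k) (f l) / 2) := by
      rw [hf]
      exact le_mul_of_one_le_left hs.le h₁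
    linarith [Real.sinh_le_sinh.mp h₂]
  have hinj : Function.Injective f := by
    intro k l hkl
    by_contra hne
    have := hsep hne
    rw [hkl, dist_self] at this
    linarith
  refine ⟨Real.exp (-C / 2) / (4 * Real.sinh C), 1 / 2, C + 2, by positivity, by norm_num,
    by linarith, fun R hR => ?_⟩
  set x : ℝ := Real.sinh ((R - C) / 2) / Real.sinh C
  have hx₀ : 0 ≤ x := div_nonneg (Real.sinh_nonneg_iff.mpr (by linarith)) hs.le
  refine ⟨(Finset.range (⌊x⌋₊ + 1)).image f, ?_, ?_, ?_⟩
  · rw [Finset.card_image_of_injective _ hinj, Finset.card_range, Nat.cast_add_one]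
    refine le_trans ?_ (Nat.lt_floor_add_one x).le
    calc Real.exp (-C / 2) / (4 * Real.sinh C) * Real.exp (1 / 2 * R)
        = Real.exp ((R - C) / 2) / 4 / Real.sinh C := by
          rw [div_mul_eq_mul_div, ← Real.exp_add, div_div]
          ring_nf
      _ ≤ x := div_le_div_of_nonneg_right (exp_div_four_le_sinh (by linarith)) hs.le
  · intro s hsS
    obtain ⟨k, hk, rfl⟩ := Finset.mem_image.mp hsS
    have hkx : (k : ℝ) ≤ x :=
      (Nat.le_floor_iff hx₀).mp (Nat.lt_succ_iff.mp (Finset.mem_range.mp hk))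
    have h : Real.sinh (dist (f k) p / 2) ≤ Real.sinh ((R - C) / 2) := by
      rw [← hf₀, hf, Nat.cast_zero, sub_zero, Nat.abs_cast]
      exact (le_div_iff₀ hs).mp hkx
    exact ball_subset_ball' (by linarith [Real.sinh_le_sinh.mp h])
  · intro s hsS t htS hst
    obtain ⟨k, -, rfl⟩ := Finset.mem_image.mp (Finset.mem_coe.mp hsS)
    obtain ⟨l, -, rfl⟩ := Finset.mem_image.mp (Finset.mem_coe.mp htS)
    exact ball_disjoint_ball (hsep fun h => hst (congrArg f h))
end

section
/- Let C > 0, let p be a point of the hyperbolic plane ℍ, and let R > 2C. Let α ∈ (0, π/2) be defined by sin α = sinh C / sinh(R − C). Then the packing number satisfies #(p, C, R) > (1/2)·(sin α / α)·(π / sinh C)·sinh(R − C); equivalently, there exists a finite set S ⊆ ℍ with |S| > (1/2)·(sin α / α)·(π / sinh C)·sinh(R − C) such that the open balls B(s, C), s ∈ S, are pairwise disjoint and contained in B(p, R). -/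
open Metric Real

theorem cosh_sub_sinh_mul_cos_pos (r θ : ℝ) : 0 < cosh r - sinh r * cos θ := by
  have h1 : |sinh r * cos θ| < cosh r := by
    refine lt_of_le_of_lt (b := |sinh r|) ?_ ?_
    · rw [abs_mul]
      exact mul_le_of_le_one_right (abs_nonneg _) (abs_cos_le_one θ)
    · exact abs_lt_of_sq_lt_sq (by nlinarith [cosh_sq r]) (cosh_pos r).le
  linarith [le_abs_self (sinh r * cos θ)]

/-- The point of the upper half-plane with geodesic polar coordinates `(r, θ)` about `p`. -/
noncomputable def UpperHalfPlane.polar (p : UpperHalfPlane) (r θ : ℝ) : UpperHalfPlane :=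
  .mk ⟨p.re + p.im * (sinh r * sin θ / (cosh r - sinh r * cos θ)),
      p.im * (1 / (cosh r - sinh r * cos θ))⟩
    (mul_pos p.im_pos (one_div_pos.2 (cosh_sub_sinh_mul_cos_pos r θ)))

theorem UpperHalfPlane.polar_re (p : UpperHalfPlane) (r θ : ℝ) :
    (p.polar r θ).re = p.re + p.im * (sinh r * sin θ / (cosh r - sinh r * cos θ)) := rfl

theorem UpperHalfPlane.polar_im (p : UpperHalfPlane) (r θ : ℝ) :
    (p.polar r θ).im = p.im * (1 / (cosh r - sinh r * cos θ)) := rfl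

theorem UpperHalfPlane.dist_polar_self (p : UpperHalfPlane) {r : ℝ} (hr : 0 ≤ r) (θ : ℝ) :
    dist (p.polar r θ) p = r := by
  refine cosh_injOn (Set.mem_Ici.2 dist_nonneg) (Set.mem_Ici.2 hr) ?_
  have hu := (cosh_sub_sinh_mul_cos_pos r θ).ne'
  have hp := p.im_ne_zero
  rw [UpperHalfPlane.cosh_dist', polar_re, polar_im]
  have hs : sin θ ^ 2 = 1 - cos θ ^ 2 := sin_sq θ
  have hc : cosh r ^ 2 = sinh r ^ 2 + 1 := cosh_sq r
  generalize cosh r = c at *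
  generalize sinh r = s at *
  field_simp
  linear_combination p.im ^ 2 * s ^ 2 * hs - p.im ^ 2 * hc

/-- The hyperbolic law of cosines for two sides of equal length `r`. -/
theorem UpperHalfPlane.cosh_dist_polar_polar (p : UpperHalfPlane) (r θ φ : ℝ) :
    cosh (dist (p.polar r θ) (p.polar r φ)) = 1 + sinh r ^ 2 * (1 - cos (θ - φ)) := by
  have hu := (cosh_sub_sinh_mul_cos_pos r θ).ne'
  have hv := (cosh_sub_sinh_mul_cos_pos r φ).ne'
  have hp := p.im_ne_zero
  rw [UpperHalfPlane.cosh_dist', polar_re, polar_im, polar_re, polar_im, cos_sub]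
  have hs : sin θ ^ 2 = 1 - cos θ ^ 2 := sin_sq θ
  have ht : sin φ ^ 2 = 1 - cos φ ^ 2 := sin_sq φ
  have hc : cosh r ^ 2 = sinh r ^ 2 + 1 := cosh_sq r
  generalize cosh r = c at *
  generalize sinh r = s at *
  generalize cos θ = a at *
  generalize cos φ = b at *
  generalize sin θ = x at *
  generalize sin φ = y at *
  field_simp
  linear_combination p.im ^ 2 * s ^ 2 * ((c - s * b) ^ 2 * hs + (c - s * a) ^ 2 * ht)
    - p.im ^ 2 * s ^ 2 * (a - b) ^ 2 * hc

theorem UpperHalfPlane.sinh_half_dist_polar_polar (p : UpperHalfPlane) (r θ φ : ℝ) :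
    sinh (dist (p.polar r θ) (p.polar r φ) / 2) ^ 2 = (sinh r * sin ((θ - φ) / 2)) ^ 2 := by
  have h := p.cosh_dist_polar_polar r θ φ
  set d := dist (p.polar r θ) (p.polar r φ)
  have h1 : cosh d = 2 * sinh (d / 2) ^ 2 + 1 := by
    rw [show d = 2 * (d / 2) by ring, cosh_two_mul, cosh_sq]; ring_nf
  have h2 : cos (θ - φ) = 1 - 2 * sin ((θ - φ) / 2) ^ 2 := by
    rw [show θ - φ = 2 * ((θ - φ) / 2) by ring, cos_two_mul, cos_sq']; ring_nf
  rw [h1, h2] at h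
  linear_combination h / 2

theorem sin_le_sin_of_mem_Icc_pi_sub {α x : ℝ} (hα : 0 ≤ α) (hα' : α ≤ π / 2)
    (hx : x ∈ Set.Icc α (π - α)) : sin α ≤ sin x := by
  obtain ⟨h1, h2⟩ := hx
  rcases le_total x (π / 2) with h | h
  · exact sin_le_sin_of_le_of_le_pi_div_two (by linarith [pi_pos]) h h1
  · rw [← sin_pi_sub x]
    exact sin_le_sin_of_le_of_le_pi_div_two (by linarith [pi_pos]) (by linarith) (by linarith)

/-- Points on a hyperbolic circle of radius `r` that are seen from its centre under the angle
`θ - φ` are at distance at least `2 * C` as soon as `sinh C ≤ sinh r * |sin ((θ - φ) / 2)|`. -/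
theorem UpperHalfPlane.two_mul_le_dist_polar_polar (p : UpperHalfPlane) {r C θ φ : ℝ}
    (h : sinh C ≤ |sinh r * sin ((θ - φ) / 2)|) :
    2 * C ≤ dist (p.polar r θ) (p.polar r φ) := by
  have h0 : 0 ≤ sinh (dist (p.polar r θ) (p.polar r φ) / 2) :=
    sinh_nonneg_iff.2 (by positivity)
  rw [← (sq_eq_sq_iff_abs_eq_abs _ _).1 (p.sinh_half_dist_polar_polar r θ φ), abs_of_nonneg h0,
    sinh_le_sinh] at h
  linarith

/-- **Quantitative lower bound for hyperbolic packings.**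
Let `C > 0`, `R > 2C`, and let `α ∈ (0, π/2)` satisfy `sin α = sinh C / sinh (R - C)`.
Then there exist strictly more than `(1/2)·(sin α / α)·(π / sinh C)·sinh (R - C)`
pairwise disjoint open balls of radius `C` inside the ball `B(p, R)` of the
hyperbolic plane. -/
theorem hyperbolic_packing_lower_bound
    (C R : ℝ) (hC : 0 < C) (hR : 2 * C < R) (p : UpperHalfPlane)
    (α : ℝ) (hα : α ∈ Set.Ioo 0 (π / 2))
    (hsin : Real.sin α = Real.sinh C / Real.sinh (R - C)) :
    ∃ S : Finset UpperHalfPlane,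
      (1 / 2) * (Real.sin α / α) * (π / Real.sinh C) * Real.sinh (R - C) < (S.card : ℝ) ∧
      (∀ s ∈ S, ball s C ⊆ ball p R) ∧
      (S : Set UpperHalfPlane).Pairwise fun s t => Disjoint (ball s C) (ball t C) := by
  classical
  obtain ⟨hα0, hα1⟩ := hα
  have hr : 0 < R - C := by linarith
  have hsr : 0 < sinh (R - C) := sinh_pos_iff.2 hr
  have hsC : 0 < sinh C := sinh_pos_iff.2 hC
  have hmul : sinh (R - C) * sin α = sinh C := by rw [hsin]; field_simp
  set N := ⌊π / α⌋₊
  have hN : N * α ≤ π := (le_div_iff₀ hα0).1 (Nat.floor_le (by positivity))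
  let f : ℕ → UpperHalfPlane := fun k => p.polar (R - C) (2 * α * k)
  have hlt : ∀ j k : ℕ, j < k → k < N → 2 * C ≤ dist (f k) (f j) := by
    intro j k hjk hkN
    refine p.two_mul_le_dist_polar_polar (le_trans ?_ (le_abs_self _))
    rw [← hmul]
    refine mul_le_mul_of_nonneg_left (sin_le_sin_of_mem_Icc_pi_sub hα0.le hα1.le ?_) hsr.le
    have h1 : (j : ℝ) + 1 ≤ k := by exact_mod_cast hjk
    have h2 : (k : ℝ) + 1 ≤ N := by exact_mod_cast hkN
    have h3 : (0 : ℝ) ≤ j := j.cast_nonneg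
    constructor <;> nlinarith
  have hsep : ∀ j < N, ∀ k < N, j ≠ k → 2 * C ≤ dist (f j) (f k) := by
    intro j hj k hk hjk
    rcases lt_or_gt_of_ne hjk with h | h
    · rw [dist_comm]
      exact hlt j k h hk
    · exact hlt k j h hj
  have hinj : Set.InjOn f (Finset.range N) := by
    intro j hj k hk hjk
    by_contra hne
    have := hsep j (by simpa using hj) k (by simpa using hk) hne
    rw [hjk, dist_self] at this
    linarith
  refine ⟨(Finset.range N).image f, ?_, ?_, ?_⟩
  · rw [Finset.card_image_of_injOn hinj, Finset.card_range]
    have hval : (1 / 2) * (sin α / α) * (π / sinh C) * sinh (R - C) = π / α / 2 := by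
      rw [hsin]; field_simp
    have h1 : π / α < N + 1 := Nat.lt_floor_add_one _
    have h2 : (2 : ℝ) ≤ N := by
      have : 2 ≤ N := Nat.le_floor (by rw [le_div_iff₀ hα0]; push_cast; linarith)
      exact_mod_cast this
    rw [hval]
    linarith
  · intro s hs
    obtain ⟨k, -, rfl⟩ := Finset.mem_image.1 hs
    exact ball_subset_ball' (by rw [p.dist_polar_self hr.le]; linarith)
  · intro s hs t ht hst
    obtain ⟨j, hj, rfl⟩ := Finset.mem_image.1 (Finset.mem_coe.1 hs)
    obtain ⟨k, hk, rfl⟩ := Finset.mem_image.1 (Finset.mem_coe.1 ht)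
    refine ball_disjoint_ball ?_
    have := hsep j (Finset.mem_range.1 hj) k (Finset.mem_range.1 hk) (by rintro rfl; exact hst rfl)
    linarith
end

section
/- For every C > 0, every point p of the hyperbolic plane ℍ, and every positive integer n, the packing number #(p, C, R) grows faster than any polynomial: #(p, C, R) / Rⁿ → ∞ as R → ∞. -/
open Metric Filter

/-- The packing number `#(p, C, R)`: the maximal cardinality of a finite set `S ⊆ ℍ`
such that the open balls `B(s, C)`, `s ∈ S`, are pairwise disjoint and all contained
in the open ball `B(p, R)`. -/
noncomputable def hypPackingNumber (p : UpperHalfPlane) (C R : ℝ) : ℕ :=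
  sSup {m : ℕ | ∃ S : Finset UpperHalfPlane, S.card = m ∧
    (∀ s ∈ S, ball s C ⊆ ball p R) ∧
    (S : Set UpperHalfPlane).Pairwise fun s t => Disjoint (ball s C) (ball t C)}

/-- In a proper metric space, the sizes of the families of pairwise disjoint balls of a fixed
positive radius inside a given ball are bounded. -/
theorem bddAbove_card_pairwise_disjoint_ball {X : Type*} [MetricSpace X] [ProperSpace X]
    (p : X) {C : ℝ} (hC : 0 < C) (R : ℝ) :
    BddAbove {m : ℕ | ∃ S : Finset X, S.card = m ∧ (∀ s ∈ S, ball s C ⊆ ball p R) ∧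
      (S : Set X).Pairwise fun s t => Disjoint (ball s C) (ball t C)} := by
  obtain ⟨T, hT, hcover⟩ := Metric.totallyBounded_iff.1
    (isCompact_closedBall p R).totallyBounded (C / 2) (half_pos hC)
  refine ⟨hT.toFinset.card, ?_⟩
  rintro _ ⟨S, rfl, hsub, hdisj⟩
  have key : ∀ s ∈ S, ∃ t ∈ T, dist s t < C / 2 := fun s hs => by
    simpa using hcover (ball_subset_closedBall (hsub s hs (mem_ball_self hC)))
  choose! f hfT hf using key
  refine Finset.card_le_card_of_injOn f (fun s hs => by simpa using hfT s hs) ?_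
  intro s hs t ht hst
  by_contra hne
  refine Set.disjoint_left.1 (hdisj hs ht hne) (mem_ball_self hC) (mem_ball.2 ?_)
  have h₁ := hf s hs
  have h₂ := hf t ht
  rw [← hst] at h₂
  linarith [dist_triangle_right s t (f s)]

namespace UpperHalfPlane

/-- The hyperbolic distance between two points on a horocycle centred at `∞`. -/
theorem sinh_half_dist_vadd_vadd (p : UpperHalfPlane) (x y : ℝ) :
    Real.sinh (dist (x +ᵥ p) (y +ᵥ p) / 2) = |x - y| / (2 * p.im) := by
  rw [sinh_half_dist, vadd_im, vadd_im, Real.sqrt_mul_self p.im_pos.le, coe_vadd, coe_vadd,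
    dist_add_right, Complex.dist_eq, ← Complex.ofReal_sub, Complex.norm_real, Real.norm_eq_abs]

end UpperHalfPlane

/-- Points placed along a horocycle through `p` give an exponentially large packing. -/
theorem sinh_div_sinh_le_hypPackingNumber (p : UpperHalfPlane) {C R : ℝ} (hC : 0 < C)
    (hR : C ≤ R) :
    Real.sinh ((R - C) / 2) / Real.sinh C ≤ hypPackingNumber p C R := by
  have hs : 0 < Real.sinh C := Real.sinh_pos_iff.2 hC
  have hy := p.im_pos
  set N := ⌊Real.sinh ((R - C) / 2) / Real.sinh C⌋₊
  let f : ℕ → UpperHalfPlane := fun k => (2 * p.im * Real.sinh C * k : ℝ) +ᵥ p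
  have hdist (j k : ℕ) :
      Real.sinh (dist (f j) (f k) / 2) = Real.sinh C * |(j : ℝ) - k| := by
    rw [UpperHalfPlane.sinh_half_dist_vadd_vadd, ← mul_sub, abs_mul,
      abs_of_pos (by positivity : 0 < 2 * p.im * Real.sinh C)]
    field_simp
  have hsep {j k : ℕ} (hjk : j ≠ k) : 2 * C ≤ dist (f j) (f k) := by
    have h1 : (1 : ℝ) ≤ |(j : ℝ) - k| := by
      exact_mod_cast Int.one_le_abs (sub_ne_zero.2 (Nat.cast_injective.ne hjk : (j : ℤ) ≠ k))
    have h2 : Real.sinh C ≤ Real.sinh (dist (f j) (f k) / 2) := by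
      rw [hdist]
      exact le_mul_of_one_le_right hs.le h1
    linarith [Real.sinh_le_sinh.1 h2]
  have hinj : Function.Injective f := fun j k hjk => by
    by_contra hne
    have := hsep hne
    rw [hjk, dist_self] at this
    linarith
  have hzero : f 0 = p := by simp [f]
  have hmem : N + 1 ≤ hypPackingNumber p C R := by
    refine le_csSup (bddAbove_card_pairwise_disjoint_ball p hC R)
      ⟨(Finset.range (N + 1)).map ⟨f, hinj⟩, by simp, ?_, ?_⟩
    · intro s hsmem
      obtain ⟨k, hk, rfl⟩ := Finset.mem_map.1 hsmem
      have hkN : (k : ℝ) ≤ Real.sinh ((R - C) / 2) / Real.sinh C :=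
        (Nat.cast_le.2 (Nat.lt_succ_iff.1 (Finset.mem_range.1 hk))).trans
          (Nat.floor_le (div_nonneg (Real.sinh_nonneg_iff.2 (by linarith)) hs.le))
      have h : Real.sinh (dist (f k) p / 2) ≤ Real.sinh ((R - C) / 2) := by
        rw [← hzero, hdist]
        simpa [mul_comm] using (le_div_iff₀ hs).1 hkN
      refine ball_subset_ball' ?_
      change C + dist (f k) p ≤ R
      linarith [Real.sinh_le_sinh.1 h]
    · intro s hs' t ht hst
      obtain ⟨j, -, rfl⟩ := Finset.mem_map.1 (Finset.mem_coe.1 hs')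
      obtain ⟨k, -, rfl⟩ := Finset.mem_map.1 (Finset.mem_coe.1 ht)
      refine ball_disjoint_ball ?_
      have := hsep (j := j) (k := k) fun h => hst (by rw [h])
      change C + C ≤ dist (f j) (f k)
      linarith
  exact (Nat.lt_floor_add_one _).le.trans (by exact_mod_cast hmem)

/-- **Superpolynomial growth of hyperbolic packing numbers:** for every `C > 0`,
`p ∈ ℍ` and `n ≥ 1`, one has `#(p, C, R) / Rⁿ → ∞` as `R → ∞`. -/
theorem hyperbolic_packing_superpolynomial (C : ℝ) (hC : 0 < C) (p : UpperHalfPlane)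
    (n : ℕ) (hn : 1 ≤ n) :
    Tendsto (fun R : ℝ => (hypPackingNumber p C R : ℝ) / R ^ n) atTop atTop := by
  have hs : 0 < Real.sinh C := Real.sinh_pos_iff.2 hC
  have hlim := (Real.tendsto_mul_exp_add_div_pow_atTop
    (Real.exp (-C / 2) / (2 ^ n * (2 * Real.sinh C))) (-1 / (2 ^ n * (2 * Real.sinh C))) n
    (by positivity)).comp (tendsto_id.atTop_div_const (two_pos : (0 : ℝ) < 2))
  refine tendsto_atTop_mono' _ ?_ hlim
  filter_upwards [eventually_ge_atTop C] with R hR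
  have hRpos : 0 < R := hC.trans_le hR
  calc _ = (Real.exp ((R - C) / 2) - 1) / 2 / Real.sinh C / R ^ n := by
        rw [show (R - C) / 2 = -C / 2 + R / 2 by ring, Real.exp_add]
        simp only [Function.comp_apply, id_eq, div_pow]
        field_simp
        ring
    _ ≤ Real.sinh ((R - C) / 2) / Real.sinh C / R ^ n := by
        rw [Real.sinh_eq ((R - C) / 2)]
        gcongr
        exact Real.exp_le_one_iff.2 (by linarith)
    _ ≤ _ := by
        gcongr
        exact sinh_div_sinh_le_hypPackingNumber p hC hR
end

section
/- Let n ≥ 1 be an integer and let F : ℍ → ℝⁿ be a Lipschitz map from the hyperbolic plane to Euclidean n-space. Then for every C > 0 and every integer k ≥ 2 there exist points p₁, …, p_k ∈ ℍ such that d(p_i, p_j) ≥ 2C for all distinct i, j ∈ {1, …, k}, and ‖F(p_i) − F(p_j)‖ < 2/C for all i, j ∈ {1, …, k}. -/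
open Finset in
/-- Pigeonhole principle for a bounded family of vectors in `ℝⁿ`: among sufficiently many of them,
`k` are pairwise close. -/
lemma exists_embedding_norm_sub_le {ι : Type*} [Fintype ι] {n : ℕ}
    (v : ι → EuclideanSpace ℝ (Fin n)) {δ : ℝ} (hδ : 0 < δ) (K k : ℕ)
    (hv : ∀ i, ‖v i‖ ≤ K * δ) (hcard : (2 * K + 1) ^ n * k ≤ Fintype.card ι) :
    ∃ e : Fin k ↪ ι, ∀ i j, ‖v (e i) - v (e j)‖ ≤ n * δ := by
  classical
  let cell : ι → Fin n → ℤ := fun i l => ⌊v i l / δ⌋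
  let t : Finset (Fin n → ℤ) := Fintype.piFinset fun _ => Icc (-(K : ℤ)) K
  have ht : #t = (2 * K + 1) ^ n := by
    simp only [t, Fintype.card_piFinset, Int.card_Icc, prod_const, card_univ, Fintype.card_fin]
    congr 1
    omega
  have hmaps : ∀ i ∈ univ, cell i ∈ t := by
    intro i _
    simp only [t, cell, Fintype.mem_piFinset, mem_Icc]
    intro l
    have h : |v i l / δ| ≤ K := by
      rw [abs_div, abs_of_pos hδ, div_le_iff₀ hδ]
      exact (PiLp.norm_apply_le (v i) l).trans (hv i)
    obtain ⟨h₁, h₂⟩ := abs_le.1 h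
    constructor
    · exact Int.le_floor.2 (by push_cast; exact h₁)
    · have : ((⌊v i l / δ⌋ : ℤ) : ℝ) ≤ K := (Int.floor_le _).trans h₂
      exact_mod_cast this
  have hne : t.Nonempty := card_pos.1 (by rw [ht]; positivity)
  obtain ⟨c, -, hc⟩ := exists_le_card_fiber_of_mul_le_card_of_maps_to hmaps hne
    (by rw [ht, card_univ]; exact hcard)
  obtain ⟨s, hs, hsk⟩ := exists_subset_card_eq hc
  let e : Fin k ↪ ι := (s.equivFinOfCardEq hsk).symm.toEmbedding.trans (.subtype _)
  have he : ∀ i, cell (e i) = c := fun i =>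
    (mem_filter.1 (hs ((s.equivFinOfCardEq hsk).symm i).2)).2
  refine ⟨e, fun i j => ?_⟩
  have hcoord : ∀ l, ‖(v (e i) - v (e j)) l‖ ≤ δ := by
    intro l
    have h : ⌊v (e i) l / δ⌋ = ⌊v (e j) l / δ⌋ := congrFun ((he i).trans (he j).symm) l
    have := Int.abs_sub_lt_one_of_floor_eq_floor h
    rw [← sub_div, abs_div, abs_of_pos hδ, div_lt_one hδ] at this
    exact this.le
  rw [EuclideanSpace.norm_eq]
  refine Real.sqrt_le_iff.2 ⟨by positivity, ?_⟩
  calc ∑ l, ‖(v (e i) - v (e j)) l‖ ^ 2 ≤ ∑ _l : Fin n, δ ^ 2 :=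
        sum_le_sum fun l _ => pow_le_pow_left₀ (norm_nonneg _) (hcoord l) 2
    _ = n * δ ^ 2 := by simp
    _ ≤ (n * δ) ^ 2 := by
        rw [mul_pow]
        gcongr
        exact_mod_cast Nat.le_self_pow two_ne_zero n

lemma Real.arsinh_le_log_one_add_two_mul {x : ℝ} (hx : 0 ≤ x) :
    Real.arsinh x ≤ Real.log (1 + 2 * x) := by
  rw [Real.arsinh]
  refine Real.log_le_log (by positivity) ?_
  have : √(1 + x ^ 2) ≤ 1 + x := Real.sqrt_le_iff.2 ⟨by positivity, by nlinarith⟩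
  linarith

/-- Distance between two points of the horocycle at height `1`. -/
lemma UpperHalfPlane.dist_of_im_eq_one {z w : UpperHalfPlane} (hz : z.im = 1) (hw : w.im = 1) :
    dist z w = 2 * Real.arsinh (|z.re - w.re| / 2) := by
  rw [UpperHalfPlane.dist_eq, Complex.dist_of_im_eq (by simp [hz, hw]), hz, hw, Real.dist_eq]
  simp

/-- The hyperbolic plane contains `2 ^ r` points that are pairwise `2 * C` apart and whose mutual
distances grow at most linearly in `r`. -/
lemma UpperHalfPlane.exists_separated {C : ℝ} (hC : 0 < C) : ∃ β : ℝ, 0 ≤ β ∧ ∀ r : ℕ,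
    ∃ q : Fin (2 ^ r) → UpperHalfPlane, (∀ i j, i ≠ j → 2 * C ≤ dist (q i) (q j)) ∧
      ∀ i j, dist (q i) (q j) ≤ 2 * (β + r) := by
  have hs : 0 < Real.sinh C := Real.sinh_pos_iff.2 hC
  refine ⟨Real.log (1 + 2 * Real.sinh C), Real.log_nonneg (by linarith), fun r => ?_⟩
  let q : Fin (2 ^ r) → UpperHalfPlane := fun i => ⟨⟨i * (2 * Real.sinh C), 1⟩, one_pos⟩
  have hq : ∀ i j, dist (q i) (q j) =
      2 * Real.arsinh (|(i : ℝ) - (j : ℝ)| * Real.sinh C) := by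
    intro i j
    rw [UpperHalfPlane.dist_of_im_eq_one rfl rfl]
    change 2 * Real.arsinh (|(i : ℝ) * (2 * Real.sinh C) - (j : ℝ) * (2 * Real.sinh C)| / 2) = _
    rw [← sub_mul, abs_mul, abs_of_pos (by positivity : 0 < 2 * Real.sinh C)]
    ring_nf
  refine ⟨q, fun i j hij => ?_, fun i j => ?_⟩
  · have h1 : (1 : ℝ) ≤ |(i : ℝ) - (j : ℝ)| := by
      have : (1 : ℤ) ≤ |(i : ℤ) - (j : ℤ)| :=
        Int.one_le_abs (sub_ne_zero.2 (by exact_mod_cast Fin.val_ne_of_ne hij))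
      exact_mod_cast this
    have : C ≤ Real.arsinh (|(i : ℝ) - (j : ℝ)| * Real.sinh C) := by
      rw [← Real.arsinh_sinh C, Real.arsinh_le_arsinh, Real.arsinh_sinh]
      exact le_mul_of_one_le_left hs.le h1
    rw [hq]
    linarith
  · have hi : (i : ℝ) ≤ 2 ^ r := by exact_mod_cast i.2.le
    have hj : (j : ℝ) ≤ 2 ^ r := by exact_mod_cast j.2.le
    have hij : |(i : ℝ) - (j : ℝ)| ≤ 2 ^ r :=
      abs_sub_le_of_nonneg_of_le (Nat.cast_nonneg _) hi (Nat.cast_nonneg _) hj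
    have h2 : (1 : ℝ) ≤ 2 ^ r := one_le_pow₀ one_le_two
    have hlog : Real.log 2 ≤ 1 := by linarith [Real.log_two_lt_d9]
    rw [hq]
    gcongr
    calc Real.arsinh (|(i : ℝ) - (j : ℝ)| * Real.sinh C)
        ≤ Real.log (1 + 2 * (|(i : ℝ) - (j : ℝ)| * Real.sinh C)) :=
          Real.arsinh_le_log_one_add_two_mul (by positivity)
      _ ≤ Real.log ((1 + 2 * Real.sinh C) * 2 ^ r) := by
          refine Real.log_le_log (by positivity) ?_
          nlinarith [mul_le_mul_of_nonneg_right hij hs.le]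
      _ = Real.log (1 + 2 * Real.sinh C) + r * Real.log 2 := by
          rw [Real.log_mul (by positivity) (by positivity), Real.log_pow]
      _ ≤ Real.log (1 + 2 * Real.sinh C) + r := by
          gcongr
          exact mul_le_of_le_one_right (Nat.cast_nonneg r) hlog

open Filter in
/-- Exponential growth beats polynomial growth. -/
lemma Nat.exists_mul_pow_mul_le_two_pow (a n k : ℕ) :
    ∃ r : ℕ, (a * (r + 1)) ^ n * k ≤ 2 ^ r := by
  have h := (tendsto_pow_const_div_const_pow_of_one_lt n (one_lt_two (α := ℝ))).comp
    (tendsto_add_atTop_nat 1)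
  have hpos : (0 : ℝ) < 1 / (2 * a ^ n * k + 1) := by positivity
  obtain ⟨r, hr⟩ := (h.eventually (gt_mem_nhds hpos)).exists
  refine ⟨r, ?_⟩
  simp only [Function.comp_apply, Nat.cast_add, Nat.cast_one] at hr
  rw [div_lt_div_iff₀ (by positivity) (by positivity), pow_succ (2 : ℝ)] at hr
  have hn : (0 : ℝ) ≤ ((r : ℝ) + 1) ^ n := by positivity
  have : ((a : ℝ) * (r + 1)) ^ n * k ≤ 2 ^ r := by
    rw [mul_pow]
    nlinarith
  exact_mod_cast this

/-- **Compression of centers under a Lipschitz map of the hyperbolic plane.**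
For any Lipschitz `F : ℍ → ℝⁿ`, any `C > 0` and any `k ≥ 2`, there are points
`p₁, …, p_k ∈ ℍ` with `d(pᵢ, pⱼ) ≥ 2C` for all `i ≠ j`, while
`‖F(pᵢ) - F(pⱼ)‖ < 2/C` for all `i, j`. -/
theorem hyperbolic_lipschitz_center_compression
    (n : ℕ) (hn : 1 ≤ n) (F : UpperHalfPlane → EuclideanSpace ℝ (Fin n))
    (hF : ∃ L : ℝ, 0 ≤ L ∧ ∀ x y : UpperHalfPlane, ‖F x - F y‖ ≤ L * dist x y)
    (C : ℝ) (hC : 0 < C) (k : ℕ) (hk : 2 ≤ k) :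
    ∃ p : Fin k → UpperHalfPlane,
      (∀ i j : Fin k, i ≠ j → 2 * C ≤ dist (p i) (p j)) ∧
      (∀ i j : Fin k, ‖F (p i) - F (p j)‖ < 2 / C) := by
  obtain ⟨L, hL, hF⟩ := hF
  obtain ⟨β, hβ, hsep⟩ := UpperHalfPlane.exists_separated hC
  have hn' : (0 : ℝ) < n := by exact_mod_cast hn
  set δ : ℝ := 1 / (C * n) with hδ_def
  have hδ : 0 < δ := by positivity
  obtain ⟨G, hG⟩ := exists_nat_ge (L * (2 * (β + 1)) / δ)
  rw [div_le_iff₀ hδ] at hG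
  obtain ⟨r, hr⟩ := Nat.exists_mul_pow_mul_le_two_pow (2 * G + 1) n k
  obtain ⟨q, hq, hq'⟩ := hsep r
  have hbound : ∀ i, ‖F (q i) - F (q 0)‖ ≤ (G * (r + 1) : ℕ) * δ := by
    intro i
    calc ‖F (q i) - F (q 0)‖ ≤ L * dist (q i) (q 0) := hF _ _
      _ ≤ L * (2 * (β + r)) := by gcongr; exact hq' i 0
      _ ≤ L * (2 * ((β + 1) * (r + 1))) := by
          gcongr
          nlinarith [mul_nonneg hβ (Nat.cast_nonneg (α := ℝ) r)]
      _ = L * (2 * (β + 1)) * (r + 1) := by ring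
      _ ≤ G * δ * (r + 1) := by gcongr
      _ = (G * (r + 1) : ℕ) * δ := by push_cast; ring
  obtain ⟨e, he⟩ := exists_embedding_norm_sub_le (fun i => F (q i) - F (q 0)) hδ
    (G * (r + 1)) k hbound <| by
      rw [Fintype.card_fin]
      refine le_trans ?_ hr
      gcongr
      nlinarith
  refine ⟨q ∘ e, fun i j hij => hq _ _ (e.injective.ne hij), fun i j => ?_⟩
  have h := he i j
  rw [sub_sub_sub_cancel_right] at h
  calc ‖F (q (e i)) - F (q (e j))‖ ≤ n * δ := h
    _ = 1 / C := by rw [hδ_def]; field_simp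
    _ < 2 / C := by gcongr; exact one_lt_two
end
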